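/- No strongly irreducible minimally unsatisfiable CNF formula with more than 2 clauses has a read-once resolution refutation (a refutation in which every clause is used as a premise at most once). -/

import Mathlib

/-- A literal: a variable (natural number) with a polarity. -/
abbrev Lit : Type := ℕ × Bool

/-- Negation of a literal. -/
def Lit.neg (ℓ : Lit) : Lit := (ℓ.1, !ℓ.2)

/-- A clause: a finite set of literals. -/
abbrev Clause : Type := Finset Lit

/-- A clause is non-tautological: it contains no literal together with its negation. -/
def Clause.NonTaut (C : Clause) : Prop := ∀ ℓ ∈ C, Lit.neg ℓ ∉ C

/-- A CNF formula: a finite set of clauses. -/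
abbrev CNF : Type := Finset Clause

/-- A CNF formula is well-formed if all of its clauses are non-tautological. -/
def CNF.WellFormed (F : CNF) : Prop := ∀ C ∈ F, C.NonTaut

/-- A (total) assignment `τ` satisfies a literal. -/
def SatLit (τ : ℕ → Bool) (ℓ : Lit) : Prop := τ ℓ.1 = ℓ.2

/-- An assignment satisfies a clause if it satisfies some literal of it. -/
def SatClause (τ : ℕ → Bool) (C : Clause) : Prop := ∃ ℓ ∈ C, SatLit τ ℓ

/-- An assignment satisfies a CNF formula if it satisfies all of its clauses. -/
def SatCNF (τ : ℕ → Bool) (F : CNF) : Prop := ∀ C ∈ F, SatClause τ C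

/-- A CNF formula is unsatisfiable if no assignment satisfies it. -/
def Unsat (F : CNF) : Prop := ¬ ∃ τ : ℕ → Bool, SatCNF τ F

/-- `F` entails `G`: every model of `F` is a model of `G`. -/
def Entails (F G : CNF) : Prop := ∀ τ : ℕ → Bool, SatCNF τ F → SatCNF τ G

/-- Logical equivalence of CNF formulas. -/
def Equivalent (F G : CNF) : Prop := Entails F G ∧ Entails G F

/-- Two clauses clash: one contains a literal whose negation is in the other. -/
def Clash (C D : Clause) : Prop := ∃ ℓ ∈ C, Lit.neg ℓ ∈ D

/-- A formula is hitting if every pair of distinct clauses clashes. -/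
def Hitting (F : CNF) : Prop := ∀ C ∈ F, ∀ D ∈ F, C ≠ D → Clash C D

/-- The set of variables occurring in a CNF formula. -/
def cnfVars (F : CNF) : Finset ℕ := F.sup fun C => C.image Prod.fst

/-- `D` is the resolvent of `C₁` and `C₂` (on the unique clashing literal `ℓ`). -/
def Resolvent (C₁ C₂ D : Clause) : Prop :=
  ∃ ℓ : Lit, C₁ ∩ C₂.image Lit.neg = {ℓ} ∧ D = (C₁ ∪ C₂) \ {ℓ, Lit.neg ℓ}

/-- `L` is a resolution refutation of `F`: every clause of the sequence is an axiom
(clause of `F`) or a resolvent of two earlier clauses, and the last clause is empty. -/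
def IsRefutation (F : CNF) (L : List Clause) : Prop :=
  L ≠ [] ∧ L.getLast? = some (∅ : Clause) ∧
    ∀ i < L.length, L.getD i ∅ ∈ F ∨
      ∃ j k, j < i ∧ k < i ∧ Resolvent (L.getD j ∅) (L.getD k ∅) (L.getD i ∅)

/-- Resolution hardness: the minimum length of a resolution refutation. -/
noncomputable def hardness (F : CNF) : ℕ :=
  sInf {n | ∃ L : List Clause, IsRefutation F L ∧ L.length = n}

/-- The restriction `F[¬C]`: the result of setting all literals of `C` to 0 in `F`. -/
def restrictByNegC (F : CNF) (C : Clause) : CNF :=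
  (F.filter fun D => ∀ ℓ ∈ C, Lit.neg ℓ ∉ D).image fun D => D \ C

/-- `C` is a clause interpolant of `(F, H)`: `F ⊨ C` and `{C} ∪ H` is unsatisfiable. -/
def ClauseInterpolant (C : Clause) (F H : CNF) : Prop :=
  C.NonTaut ∧ Entails F {C} ∧ Unsat (insert C H)

/-- `F` is a factor of `G`: a subset of `G` logically equivalent to a single clause. -/
def IsFactor (F G : CNF) : Prop :=
  F ⊆ G ∧ ∃ C : Clause, C.NonTaut ∧ Equivalent F {C}

/-- `F` is a pseudo-factor of `G`: `(F, G \ F)` has a clause interpolant. -/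
def IsPseudoFactor (F G : CNF) : Prop :=
  F ⊆ G ∧ ∃ C : Clause, ClauseInterpolant C F (G \ F)

/-- `G` is irreducible: every factor has size 1 or `|G|`. -/
def CNF.Irreducible (G : CNF) : Prop :=
  ∀ F : CNF, IsFactor F G → F.card = 1 ∨ F.card = G.card

/-- `G` is strongly irreducible: every pseudo-factor has size 1 or `|G|`. -/
def StronglyIrreducible (G : CNF) : Prop :=
  ∀ F : CNF, IsPseudoFactor F G → F.card = 1 ∨ F.card = G.card

/-- `F` is minimally unsatisfiable: unsatisfiable, but every proper subset is satisfiable. -/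
def MinimallyUnsat (F : CNF) : Prop :=
  Unsat F ∧ ∀ G : CNF, G ⊂ F → ∃ τ : ℕ → Bool, SatCNF τ G

/-- A resolution refutation of `F` with a fixed history: a sequence of clauses ending
in the empty clause, where each clause is an axiom (history `none`) or the resolvent
of the two earlier clauses recorded in its history. -/
structure Refutation (F : CNF) where
  seq : List Clause
  hist : ℕ → Option (ℕ × ℕ)
  ne : seq ≠ []
  lastEmpty : seq.getLast? = some (∅ : Clause)
  valid : ∀ i < seq.length,
    (hist i = none ∧ seq.getD i ∅ ∈ F) ∨
      ∃ j k, hist i = some (j, k) ∧ j < i ∧ k < i ∧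
        Resolvent (seq.getD j ∅) (seq.getD k ∅) (seq.getD i ∅)

/-- The clause at position `j` is used as a premise of the resolution step at
position `i`. -/
def Refutation.UsesAt {F : CNF} (P : Refutation F) (i j : ℕ) : Prop :=
  i < P.seq.length ∧ ∃ k, P.hist i = some (j, k) ∨ P.hist i = some (k, j)

/-- `P` is read-once: every clause is used as a premise of at most one resolution step
(a clause value has at most one use in the whole refutation). -/
def Refutation.ReadOnce {F : CNF} (P : Refutation F) : Prop :=
  ∀ i₁ j₁ i₂ j₂ : ℕ, P.UsesAt i₁ j₁ → P.UsesAt i₂ j₂ →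
    P.seq.getD j₁ ∅ = P.seq.getD j₂ ∅ → i₁ = i₂ ∧ j₁ = j₂

theorem Lit.neg_neg (l : Lit) : Lit.neg (Lit.neg l) = l := by
  simp [Lit.neg]

theorem Lit.neg_ne (l : Lit) : Lit.neg l ≠ l := by
  intro h
  have := congrArg Prod.snd h
  simp [Lit.neg] at this

theorem SatLit.not_neg {τ : ℕ → Bool} {l : Lit} (h : SatLit τ l) : ¬ SatLit τ (Lit.neg l) := by
  simp only [SatLit, Lit.neg] at *
  simp [h]

theorem clash_mem_iff {A B : Clause} {l : Lit} (h : A ∩ B.image Lit.neg = {l}) (x : Lit) :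
    x ∈ A ∧ Lit.neg x ∈ B ↔ x = l := by
  rw [← Finset.mem_singleton, ← h, Finset.mem_inter, Finset.mem_image]
  constructor
  · rintro ⟨hA, hB⟩
    exact ⟨hA, _, hB, Lit.neg_neg x⟩
  · rintro ⟨hA, y, hy, rfl⟩
    exact ⟨hA, by rwa [Lit.neg_neg]⟩

theorem Resolvent.nonempty_left {A B D : Clause} (h : Resolvent A B D) : A ≠ ∅ := by
  obtain ⟨l, hl, -⟩ := h
  exact Finset.ne_empty_of_mem ((clash_mem_iff hl l).2 rfl).1

theorem Resolvent.nonempty_right {A B D : Clause} (h : Resolvent A B D) : B ≠ ∅ := by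
  obtain ⟨l, hl, -⟩ := h
  exact Finset.ne_empty_of_mem ((clash_mem_iff hl l).2 rfl).2

theorem Resolvent.ne {A B D : Clause} (h : Resolvent A B D) : A ≠ B := by
  rintro rfl
  obtain ⟨l, hl, -⟩ := h
  obtain ⟨h₁, h₂⟩ := (clash_mem_iff hl l).2 rfl
  exact Lit.neg_ne l ((clash_mem_iff hl _).1 ⟨h₂, by rwa [Lit.neg_neg]⟩)

/-- Resolution of non-tautological clauses is sound. -/
theorem Resolvent.satClause {A B D : Clause} (h : Resolvent A B D) (tA : A.NonTaut)
    (tB : B.NonTaut) {τ : ℕ → Bool} (hA : SatClause τ A) (hB : SatClause τ B) : SatClause τ D := by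
  obtain ⟨l, hl, rfl⟩ := h
  by_contra hD
  have key : ∀ x ∈ A ∪ B, SatLit τ x → x = l ∨ x = Lit.neg l := by
    intro x hx sx
    by_contra hne
    exact hD ⟨x, by simpa [Finset.mem_sdiff] using ⟨by simpa using hx, by simpa using hne⟩, sx⟩
  obtain ⟨a, ha, sa⟩ := hA
  obtain ⟨b, hb, sb⟩ := hB
  obtain ⟨hlA, hlB⟩ := (clash_mem_iff hl l).2 rfl
  have sl : SatLit τ l := by
    rcases key a (Finset.mem_union_left _ ha) sa with rfl | rfl
    · exact sa
    · exact absurd ha (tA l hlA)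
  have snl : SatLit τ (Lit.neg l) := by
    rcases key b (Finset.mem_union_right _ hb) sb with rfl | rfl
    · exact absurd hlB (tB _ hb)
    · exact sb
  exact sl.not_neg snl

theorem Resolvent.nonTaut {A B D : Clause} (h : Resolvent A B D) (hA : A.NonTaut)
    (hB : B.NonTaut) : D.NonTaut := by
  obtain ⟨l, hl, rfl⟩ := h
  intro x hx hnx
  simp only [Finset.mem_sdiff, Finset.mem_union, Finset.mem_insert, Finset.mem_singleton,
    not_or] at hx hnx
  obtain ⟨hx | hx, hxl, -⟩ := hx <;> obtain ⟨hn | hn, hnl, -⟩ := hnx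
  · exact hA x hx hn
  · exact hxl ((clash_mem_iff hl x).1 ⟨hx, hn⟩)
  · exact hnl ((clash_mem_iff hl _).1 ⟨hn, by rwa [Lit.neg_neg]⟩)
  · exact hB x hx hn

theorem Refutation.nonTaut {F : CNF} (hwf : F.WellFormed) (P : Refutation F) :
    ∀ i < P.seq.length, (P.seq.getD i ∅).NonTaut := by
  intro i
  induction i using Nat.strong_induction_on with
  | _ i ih =>
    intro hi
    obtain ⟨-, hF⟩ | ⟨j, k, -, hj, hk, hr⟩ := P.valid i hi
    · exact hwf _ hF
    · exact hr.nonTaut (ih j hj (hj.trans hi)) (ih k hk (hk.trans hi))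

theorem Refutation.getD_last {F : CNF} (P : Refutation F) :
    P.seq.length - 1 < P.seq.length ∧ P.seq.getD (P.seq.length - 1) ∅ = ∅ := by
  refine ⟨Nat.sub_lt (List.length_pos_of_ne_nil P.ne) one_pos, ?_⟩
  have h := P.lastEmpty
  rw [List.getLast?_eq_getElem?] at h
  rw [List.getD_eq_getElem?_getD, h, Option.getD_some]

theorem not_satClause_empty (τ : ℕ → Bool) : ¬ SatClause τ ∅ := by
  rintro ⟨l, hl, -⟩
  simp at hl

theorem MinimallyUnsat.empty_notMem {F : CNF} (h : MinimallyUnsat F) (hF : 1 < F.card) :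
    ∅ ∉ F := by
  intro h0
  have hss : ({∅} : CNF) ⊂ F := by
    refine Finset.ssubset_iff_subset_ne.2 ⟨by simpa using h0, ?_⟩
    rintro rfl
    simp at hF
  obtain ⟨τ, hτ⟩ := h.2 _ hss
  exact not_satClause_empty τ (hτ ∅ (by simp))

/-- A refutation of a formula without the empty clause has a step resolving two axioms. -/
theorem Refutation.exists_axiom_step {F : CNF} (P : Refutation F) (h0 : ∅ ∉ F) :
    ∃ i < P.seq.length, ∃ j k, P.hist i = some (j, k) ∧ P.seq.getD j ∅ ∈ F ∧
      P.seq.getD k ∅ ∈ F ∧ Resolvent (P.seq.getD j ∅) (P.seq.getD k ∅) (P.seq.getD i ∅) := by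
  have hex : ∃ i, i < P.seq.length ∧ P.seq.getD i ∅ ∉ F :=
    ⟨_, P.getD_last.1, by rwa [P.getD_last.2]⟩
  classical
  obtain ⟨hi, hiF⟩ := Nat.find_spec hex
  obtain ⟨-, hF⟩ | ⟨j, k, hh, hj, hk, hr⟩ := P.valid _ hi
  · exact absurd hF hiF
  · have mem : ∀ j < Nat.find hex, P.seq.getD j ∅ ∈ F := fun j hj =>
      not_not.1 fun hn => Nat.find_min hex hj ⟨hj.trans hi, hn⟩
    exact ⟨_, hi, j, k, hh, mem j hj, mem k hk, hr⟩

/-- In a read-once refutation, the premises of a step can be traded for its conclusion. -/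
theorem Refutation.ReadOnce.unsat_insert_sdiff {F : CNF} {P : Refutation F} (hP : P.ReadOnce)
    (hwf : F.WellFormed) {i j k : ℕ} (hi : i < P.seq.length) (hh : P.hist i = some (j, k))
    (hr : Resolvent (P.seq.getD j ∅) (P.seq.getD k ∅) (P.seq.getD i ∅)) :
    Unsat (insert (P.seq.getD i ∅) (F \ {P.seq.getD j ∅, P.seq.getD k ∅})) := by
  rintro ⟨τ, hτ⟩
  have useJ : P.UsesAt i j := ⟨hi, k, Or.inl hh⟩
  have useK : P.UsesAt i k := ⟨hi, j, Or.inr hh⟩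
  have key : ∀ p < P.seq.length, P.seq.getD p ∅ ≠ P.seq.getD j ∅ →
      P.seq.getD p ∅ ≠ P.seq.getD k ∅ → SatClause τ (P.seq.getD p ∅) := by
    intro p
    induction p using Nat.strong_induction_on with
    | _ p ih =>
      intro hp hpj hpk
      by_cases hpi : p = i
      · exact hpi ▸ hτ _ (Finset.mem_insert_self _ _)
      obtain ⟨-, hF⟩ | ⟨a, b, hab, ha, hb, hrp⟩ := P.valid p hp
      · exact hτ _ (Finset.mem_insert_of_mem (Finset.mem_sdiff.2
          ⟨hF, by simp only [Finset.mem_insert, Finset.mem_singleton, hpj, hpk, or_self,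
            not_false_eq_true]⟩))
      · have sat : ∀ q < p, P.UsesAt p q → SatClause τ (P.seq.getD q ∅) := fun q hq hu =>
          ih q hq (hq.trans hp) (fun h => hpi (hP _ _ _ _ hu useJ h).1)
            (fun h => hpi (hP _ _ _ _ hu useK h).1)
        exact hrp.satClause (P.nonTaut hwf a (ha.trans hp)) (P.nonTaut hwf b (hb.trans hp))
          (sat a ha ⟨hp, b, Or.inl hab⟩) (sat b hb ⟨hp, a, Or.inr hab⟩)
  obtain ⟨hlt, hlast⟩ := P.getD_last
  have h := key _ hlt (hlast.trans_ne hr.nonempty_left.symm)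
    (hlast.trans_ne hr.nonempty_right.symm)
  rw [hlast] at h
  exact not_satClause_empty τ h

/-- no strongly irreducible minimally unsatisfiable CNF formula with
more than 2 clauses has a read-once resolution refutation. -/
theorem no_read_once (F : CNF) (hwf : F.WellFormed) (hmu : MinimallyUnsat F)
    (hsi : StronglyIrreducible F) (hm : 2 < F.card) (P : Refutation F) :
    ¬ P.ReadOnce := by
  intro hP
  obtain ⟨i, hi, j, k, hh, hj, hk, hr⟩ :=
    P.exists_axiom_step (hmu.empty_notMem (one_lt_two.trans hm))
  have hent : Entails {P.seq.getD j ∅, P.seq.getD k ∅} {P.seq.getD i ∅} := by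
    intro τ hτ C hC
    rw [Finset.mem_singleton.1 hC]
    exact hr.satClause (hwf _ hj) (hwf _ hk) (hτ _ (by simp)) (hτ _ (by simp))
  have hpf : IsPseudoFactor {P.seq.getD j ∅, P.seq.getD k ∅} F :=
    ⟨Finset.insert_subset hj (Finset.singleton_subset_iff.2 hk), P.seq.getD i ∅,
      P.nonTaut hwf i hi, hent, hP.unsat_insert_sdiff hwf hi hh hr⟩
  have hcard := hsi _ hpf
  rw [Finset.card_pair hr.ne] at hcard
  omega
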